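/- Let a, b ∈ ℂ and let f : ℂ → ℂ be f(z) = conj(a·z + b). If f(f(z)) = z for all z ∈ ℂ, then the fixed point set {z ∈ ℂ : f(z) = z} is a real affine line: there exist z₀, c ∈ ℂ with c ≠ 0 such that {z ∈ ℂ : f(z) = z} = {z₀ + t·c : t ∈ ℝ}. -/

import Mathlib

open ComplexConjugate in
/-- A rotation followed by conjugation fixes a nonzero vector. -/
theorem exists_ne_zero_conj_mul_conj_eq {a : ℂ} (ha : conj a * a = 1) :
    ∃ c : ℂ, c ≠ 0 ∧ conj a * conj c = c := by
  by_cases h : 1 + conj a = 0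
  · refine ⟨Complex.I, Complex.I_ne_zero, ?_⟩
    rw [eq_neg_of_add_eq_zero_right h, Complex.conj_I]
    ring
  · refine ⟨1 + conj a, h, ?_⟩
    simp only [map_add, map_one, Complex.conj_conj]
    linear_combination ha

open ComplexConjugate in
/-- The vectors fixed by a rotation followed by conjugation are real multiples of each other. -/
theorem exists_real_mul_of_conj_mul_conj_eq {a c w : ℂ} (hc : c ≠ 0)
    (hac : conj a * conj c = c) (haw : conj a * conj w = w) :
    ∃ t : ℝ, w = t * c := by
  have ha : conj a ≠ 0 := fun h => hc (by rw [← hac, h, zero_mul])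
  have hc' : conj c ≠ 0 := (map_ne_zero _).2 hc
  have hreal : conj (w / c) = w / c := by
    rw [map_div₀, div_eq_div_iff hc' hc]
    apply mul_left_cancel₀ ha
    linear_combination c * haw - w * hac
  obtain ⟨t, ht⟩ := Complex.conj_eq_iff_real.1 hreal
  exact ⟨t, by rw [← ht, div_mul_cancel₀ w hc]⟩

theorem stmt_7 (a b : ℂ) (f : ℂ → ℂ)
    (hf : ∀ z, f z = (starRingEnd ℂ) (a * z + b))
    (hinv : ∀ z, f (f z) = z) :
    ∃ z₀ c : ℂ, c ≠ 0 ∧ {z : ℂ | f z = z} = {z : ℂ | ∃ t : ℝ, z = z₀ + (t : ℂ) * c} := by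
  simp only [hf, map_add, map_mul, Complex.conj_conj] at hinv
  have h0 := hinv 0
  have h1 := hinv 1
  obtain ⟨c, hc, hac⟩ := exists_ne_zero_conj_mul_conj_eq (a := a)
    (by linear_combination h1 - h0)
  refine ⟨(starRingEnd ℂ) b / 2, c, hc, ?_⟩
  ext z
  simp only [Set.mem_ofPred_eq, hf, map_add, map_mul]
  constructor
  · intro hz
    obtain ⟨t, ht⟩ := exists_real_mul_of_conj_mul_conj_eq (w := z - (starRingEnd ℂ) b / 2) hc hac
      (by
        simp only [map_sub, map_div₀, Complex.conj_conj, map_ofNat]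
        linear_combination hz - h0 / 2)
    exact ⟨t, by linear_combination ht⟩
  · rintro ⟨t, rfl⟩
    simp only [map_add, map_mul, map_div₀, Complex.conj_conj, map_ofNat, Complex.conj_ofReal]
    linear_combination t * hac + h0 / 2
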